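/- Let π be a partition of {1,…,k} and define S_n(π) to be the set of tuples (p_1,…,p_k) ∈ {1,…,n}^k such that p_i + p_{i+1} = p_j + p_{j+1} if and only if i ∼_π j (indices mod k, i.e., p_{k+1} := p_1). Then #S_n(π) ≤ n^{#π + 1}, where #π is the number of blocks of π. -/

import Mathlib

open Finset

/-- `i ∼_π j`: `i` and `j` lie in the same block of the partition `π`. -/
def sameBlock {k : ℕ} (P : Finpartition (Finset.univ : Finset (Fin k))) (i j : Fin k) : Prop :=
  ∃ b ∈ P.parts, i ∈ b ∧ j ∈ b

/-- `S_n(π)`: tuples `(p 1, …, p k) ∈ {1,…,n}^k` with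
`p i + p (i+1) = p j + p (j+1) ↔ i ∼_π j` (indices cyclic). -/
def consistentSet (k n : ℕ) [NeZero k] (P : Finpartition (Finset.univ : Finset (Fin k))) :
    Set (Fin k → ℕ) :=
  {p | (∀ i, 1 ≤ p i ∧ p i ≤ n) ∧
    ∀ i j : Fin k, p i + p (i + 1) = p j + p (j + 1) ↔ sameBlock P i j}

/-- `#S_n(π) ≤ n^(#π + 1)`. -/
theorem stmt3 (k n : ℕ) [NeZero k] (P : Finpartition (Finset.univ : Finset (Fin k))) :
    (consistentSet k n P).ncard ≤ n ^ (P.parts.card + 1) := by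
  classical
  have hne : ∀ b : P.parts, (b : Finset (Fin k)).Nonempty := fun b =>
    P.nonempty_of_mem_parts b.2
  let f : (Fin k → ℕ) → (Option P.parts → ℕ) := fun p o =>
    match o with
    | none => p 0
    | some b => p ((b : Finset (Fin k)).min' (hne b) + 1)
  let t : Finset (Option P.parts → ℕ) := Fintype.piFinset fun _ => Finset.Icc 1 n
  have ht : t.card = n ^ (P.parts.card + 1) := by
    simp [t]
  rw [← ht, ← Set.ncard_coe_finset]
  refine Set.ncard_le_ncard_of_injOn f ?_ ?_ t.finite_toSet
  · intro p hp
    simp only [t, Finset.mem_coe, Fintype.mem_piFinset, Finset.mem_Icc]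
    intro o
    cases o with
    | none => exact hp.1 _
    | some b => exact hp.1 _
  · intro p hp q hq hpq
    have key : ∀ i : ℕ, ∀ h : i < k, p ⟨i, h⟩ = q ⟨i, h⟩ := by
      intro i
      induction i using Nat.strong_induction_on with
      | _ i ih =>
        intro h
        cases i with
        | zero => exact congrFun hpq none
        | succ i =>
          have hi : i < k := by omega
          have hsucc : (⟨i, hi⟩ : Fin k) + 1 = ⟨i + 1, h⟩ := by
            apply Fin.ext
            rw [Fin.val_add, Fin.coe_ofNat_eq_mod, Nat.add_mod_mod]
            exact Nat.mod_eq_of_lt h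
          obtain ⟨b, hb, hib⟩ := P.exists_mem (Finset.mem_univ (⟨i, hi⟩ : Fin k))
          have hm := Finset.min'_mem b (hne ⟨b, hb⟩)
          have hle := Finset.min'_le b _ hib
          have hf : p (b.min' (hne ⟨b, hb⟩) + 1) = q (b.min' (hne ⟨b, hb⟩) + 1) :=
            congrFun hpq (some ⟨b, hb⟩)
          generalize b.min' (hne ⟨b, hb⟩) = m at hm hle hf
          have h1 := (hp.2 ⟨i, hi⟩ m).2 ⟨b, hb, hib, hm⟩
          have h2 := (hq.2 ⟨i, hi⟩ m).2 ⟨b, hb, hib, hm⟩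
          have hmi : m.val ≤ i := hle
          have h3 : p m = q m := ih m.val (by omega) m.2
          have h4 := ih i (by omega) hi
          rw [hsucc] at h1 h2
          omega
    funext i
    exact key i.val i.2
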